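/- If Z and Z' are two Λ-measurable processes such that Z_T ≤ Z'_T a.s. for every bounded Λ-stopping time T, then the set {(ω,t) : Z_t(ω) > Z'_t(ω)} is evanescent (i.e. its projection onto Ω is a P-null set). If Z_T = Z'_T a.s. for every bounded Λ-stopping time T, then Z and Z' are indistinguishable. -/

import Mathlib

open MeasureTheory Filter Set Topology
open scoped NNReal ENNReal symmDiff Classical

noncomputable section

namespace Meyer

variable {Ω : Type*}

/-- The σ-field generated by a family of real-valued functions. -/
def genBy {α : Type*} (C : Set (α → ℝ)) : MeasurableSpace α :=
  ⨆ f ∈ C, MeasurableSpace.comap f inferInstance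

/-- A function is càdlàg: right-continuous with left limits. -/
def IsCadlag (f : ℝ≥0 → ℝ) : Prop :=
  (∀ t, Tendsto f (𝓝[≥] t) (𝓝 (f t))) ∧
  ∀ t : ℝ≥0, 0 < t → ∃ l, Tendsto f (𝓝[<] t) (𝓝 l)

/-- A Meyer-σ-field over `(Ω, mΩ)`: a σ-field on `Ω × [0,∞)` contained in the product
σ-field, generated by càdlàg processes, containing `{∅,Ω} × B([0,∞))` and stable under
stopping at deterministic times. -/
structure IsMeyer (mΩ : MeasurableSpace Ω) (Λ : MeasurableSpace (Ω × ℝ≥0)) : Prop where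
  le_prod : Λ ≤ @Prod.instMeasurableSpace Ω ℝ≥0 mΩ inferInstance
  gen_cadlag : ∃ C : Set (Ω × ℝ≥0 → ℝ),
    (∀ Z ∈ C, ∀ ω, IsCadlag fun t => Z (ω, t)) ∧ Λ = genBy C
  contains_borel : ∀ B : Set ℝ≥0, MeasurableSet B → MeasurableSet[Λ] (Set.univ ×ˢ B)
  stop_stable : ∀ Z : Ω × ℝ≥0 → ℝ, Measurable[Λ] Z → ∀ s : ℝ≥0,
    Measurable[Λ] fun p => Z (p.1, min p.2 s)

/-- A `Λ`-stopping time: `[[S,∞[[ ∈ Λ`. -/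
def IsStoppingTimeM (Λ : MeasurableSpace (Ω × ℝ≥0)) (S : Ω → ℝ≥0∞) : Prop :=
  MeasurableSet[Λ] {p : Ω × ℝ≥0 | S p.1 ≤ (p.2 : ℝ≥0∞)}

/-- The associated filtration `F^Λ_t := σ(Z_t : Z Λ-measurable)`. -/
def sigmaAt (Λ : MeasurableSpace (Ω × ℝ≥0)) (t : ℝ≥0) : MeasurableSpace Ω :=
  genBy {f : Ω → ℝ | ∃ Z : Ω × ℝ≥0 → ℝ, Measurable[Λ] Z ∧ f = fun ω => Z (ω, t)}

/-- `F^Λ_∞`. -/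
def sigmaInf (Λ : MeasurableSpace (Ω × ℝ≥0)) : MeasurableSpace Ω := ⨆ t : ℝ≥0, sigmaAt Λ t

/-- A process indexed by `[0,∞]` is `Λ`-measurable if its restriction to `Ω × [0,∞)`
is `Λ`-measurable and its value at `∞` is `F^Λ_∞`-measurable. -/
def MeasurableProcessE (Λ : MeasurableSpace (Ω × ℝ≥0)) (Z : Ω × ℝ≥0∞ → ℝ) : Prop :=
  Measurable[Λ] (fun p : Ω × ℝ≥0 => Z (p.1, (p.2 : ℝ≥0∞))) ∧
  Measurable[sigmaInf Λ] fun ω => Z (ω, ∞)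

/-- `F^Λ_S := σ(Z_S : Z a Λ-measurable process on [0,∞])`. -/
def sigmaAtTime (Λ : MeasurableSpace (Ω × ℝ≥0)) (S : Ω → ℝ≥0∞) : MeasurableSpace Ω :=
  genBy {f : Ω → ℝ | ∃ Z : Ω × ℝ≥0∞ → ℝ, MeasurableProcessE Λ Z ∧ f = fun ω => Z (ω, S ω)}

/-- `S_A`: equal to `S` on `A` and `∞` off `A`. -/
def restrictST (S : Ω → ℝ≥0∞) (A : Set Ω) : Ω → ℝ≥0∞ := fun ω => if ω ∈ A then S ω else ∞

/-- Evaluation of a process indexed by `[0,∞]` at a random time. -/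
def EvalAt (Z : Ω × ℝ≥0∞ → ℝ) (S : Ω → ℝ≥0∞) : Ω → ℝ := fun ω => Z (ω, S ω)

/-- Evaluation of a process indexed by `[0,∞)` at a (finite) random time. -/
def EvalAtF (Z : Ω × ℝ≥0 → ℝ) (S : Ω → ℝ≥0∞) : Ω → ℝ := fun ω => Z (ω, (S ω).toNNReal)

/-- Adaptedness of a process to a raw filtration. -/
def Adapted' (G : ℝ≥0 → MeasurableSpace Ω) (Z : Ω × ℝ≥0 → ℝ) : Prop :=
  ∀ t, Measurable[G t] fun ω => Z (ω, t)

/-- Predictable σ-field of a filtration: generated by continuous adapted processes. -/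
def predSF (G : ℝ≥0 → MeasurableSpace Ω) : MeasurableSpace (Ω × ℝ≥0) :=
  genBy {Z | (∀ ω, Continuous fun t => Z (ω, t)) ∧ Adapted' G Z}

/-- Optional σ-field of a filtration: generated by càdlàg adapted processes. -/
def optSF (G : ℝ≥0 → MeasurableSpace Ω) : MeasurableSpace (Ω × ℝ≥0) :=
  genBy {Z | (∀ ω, IsCadlag fun t => Z (ω, t)) ∧ Adapted' G Z}

/-- Classical stopping time of a raw filtration. -/
def IsStoppingTimeCl (G : ℝ≥0 → MeasurableSpace Ω) (T : Ω → ℝ≥0∞) : Prop :=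
  ∀ t : ℝ≥0, MeasurableSet[G t] {ω | T ω ≤ (t : ℝ≥0∞)}

/-- The right-continuous filtration `F^Λ_{t+}`. -/
def FplusLambda (Λ : MeasurableSpace (Ω × ℝ≥0)) (t : ℝ≥0) : MeasurableSpace Ω :=
  ⨅ (s : ℝ≥0) (_ : t < s), sigmaAt Λ s

/-- Two processes are indistinguishable. -/
def Indistinguishable {τ : Type*} [MeasurableSpace Ω] (P : Measure Ω)
    (X Y : Ω × τ → ℝ) : Prop :=
  P {ω | ∃ t, X (ω, t) ≠ Y (ω, t)} = 0

/-- `Λ` is `P`-complete: every product-measurable process indistinguishable from a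
`Λ`-measurable process is itself `Λ`-measurable. -/
def IsPCompleteM [mΩ : MeasurableSpace Ω] (P : Measure Ω)
    (Λ : MeasurableSpace (Ω × ℝ≥0)) : Prop :=
  ∀ Z Z' : Ω × ℝ≥0 → ℝ, Measurable Z → Measurable[Λ] Z' →
    Indistinguishable P Z Z' → Measurable[Λ] Z

/-- A raw filtration satisfies the usual conditions: monotone, sub-σ-fields of `mΩ`,
right-continuous and `P`-complete. -/
def UsualConditions [mΩ : MeasurableSpace Ω] (P : Measure Ω)
    (G : ℝ≥0 → MeasurableSpace Ω) : Prop :=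
  Monotone G ∧ (∀ t, G t ≤ mΩ) ∧
  (∀ t : ℝ≥0, G t = ⨅ (s : ℝ≥0) (_ : t < s), G s) ∧
  ∀ N : Set Ω, MeasurableSet N → P N = 0 → MeasurableSet[G 0] N

variable [mΩ : MeasurableSpace Ω]

/-- `Λ`-martingale (indexed by `[0,∞]`). -/
def IsMartingaleM (P : Measure Ω) (Λ : MeasurableSpace (Ω × ℝ≥0))
    (Z : Ω × ℝ≥0∞ → ℝ) : Prop :=
  MeasurableProcessE Λ Z ∧
  (∀ S, IsStoppingTimeM Λ S → Integrable (EvalAt Z S) P) ∧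
  ∀ S T : Ω → ℝ≥0∞, IsStoppingTimeM Λ S → IsStoppingTimeM Λ T → S ≤ T →
    EvalAt Z S =ᵐ[P] P[EvalAt Z T|sigmaAtTime Λ S]

/-- `Λ`-supermartingale (indexed by `[0,∞]`). -/
def IsSupermartingaleM (P : Measure Ω) (Λ : MeasurableSpace (Ω × ℝ≥0))
    (Z : Ω × ℝ≥0∞ → ℝ) : Prop :=
  MeasurableProcessE Λ Z ∧
  (∀ S, IsStoppingTimeM Λ S → Integrable (EvalAt Z S) P) ∧
  ∀ S T : Ω → ℝ≥0∞, IsStoppingTimeM Λ S → IsStoppingTimeM Λ T → S ≤ T →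
    P[EvalAt Z T|sigmaAtTime Λ S] ≤ᵐ[P] EvalAt Z S

/-- Class `(D^Λ)` for a process: uniform integrability of `{Z_T : T ∈ S^Λ}`. -/
def ClassD (P : Measure Ω) (Λ : MeasurableSpace (Ω × ℝ≥0)) (Z : Ω × ℝ≥0∞ → ℝ) : Prop :=
  UniformIntegrable (fun S : {S : Ω → ℝ≥0∞ // IsStoppingTimeM Λ S} => EvalAt Z S.1) 1 P

/-- Class `(D^Λ)` for a system. -/
def ClassDSys (P : Measure Ω) (Λ : MeasurableSpace (Ω × ℝ≥0))
    (ZS : (Ω → ℝ≥0∞) → Ω → ℝ) : Prop :=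
  UniformIntegrable (fun S : {S : Ω → ℝ≥0∞ // IsStoppingTimeM Λ S} => ZS S.1) 1 P

/-- `pY` is a `Λ`-projection of `Y` (processes indexed by `[0,∞]`). -/
def IsProjectionE (P : Measure Ω) (Λ : MeasurableSpace (Ω × ℝ≥0))
    (Y pY : Ω × ℝ≥0∞ → ℝ) : Prop :=
  MeasurableProcessE Λ pY ∧
  ∀ S, IsStoppingTimeM Λ S → (∀ ω, S ω < ∞) →
    EvalAt pY S =ᵐ[P] P[EvalAt Y S|sigmaAtTime Λ S]

/-- `pY` is a `Λ`-projection of `Y` (processes indexed by `[0,∞)`). -/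
def IsProjectionF (P : Measure Ω) (Λ : MeasurableSpace (Ω × ℝ≥0))
    (Y pY : Ω × ℝ≥0 → ℝ) : Prop :=
  Measurable[Λ] pY ∧
  ∀ S, IsStoppingTimeM Λ S → (∀ ω, S ω < ∞) →
    EvalAtF pY S =ᵐ[P] P[EvalAtF Y S|sigmaAtTime Λ S]

/-- Right-upper-semicontinuous envelope `Z^*` (with `Z^*_∞ := Z_∞`). -/
def rightLimsup (Z : Ω × ℝ≥0∞ → ℝ) (ω : Ω) (t : ℝ≥0∞) : ℝ :=
  if t = ∞ then Z (ω, ∞)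
  else limsup (fun s : ℝ≥0 => Z (ω, (s : ℝ≥0∞))) (𝓝[>] t.toNNReal)

/-- Right-lower-semicontinuous envelope `Z_*` (with `Z_{∞*} := Z_∞`). -/
def rightLiminf (Z : Ω × ℝ≥0∞ → ℝ) (ω : Ω) (t : ℝ≥0∞) : ℝ :=
  if t = ∞ then Z (ω, ∞)
  else liminf (fun s : ℝ≥0 => Z (ω, (s : ℝ≥0∞))) (𝓝[>] t.toNNReal)

/-- Left-upper-semicontinuous envelope `*Z` (with `*Z_0 := Z_0` and
`*Z_∞ := limsup_{t↑∞} Z_t`). -/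
def leftLimsup (Z : Ω × ℝ≥0∞ → ℝ) (ω : Ω) (t : ℝ≥0∞) : ℝ :=
  if t = 0 then Z (ω, 0)
  else if t = ∞ then limsup (fun s : ℝ≥0 => Z (ω, (s : ℝ≥0∞))) atTop
  else limsup (fun s : ℝ≥0 => Z (ω, (s : ℝ≥0∞))) (𝓝[<] t.toNNReal)

/-- Left-lower-semicontinuous envelope `_*Z`. -/
def leftLiminf (Z : Ω × ℝ≥0∞ → ℝ) (ω : Ω) (t : ℝ≥0∞) : ℝ :=
  if t = 0 then Z (ω, 0)
  else if t = ∞ then liminf (fun s : ℝ≥0 => Z (ω, (s : ℝ≥0∞))) atTop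
  else liminf (fun s : ℝ≥0 => Z (ω, (s : ℝ≥0∞))) (𝓝[<] t.toNNReal)

/-- `T` is `Λ`-accessible. -/
def IsAccessibleM [mΩ2 : MeasurableSpace Ω] (P : Measure Ω)
    (Λ : MeasurableSpace (Ω × ℝ≥0)) (T : Ω → ℝ≥0∞) : Prop :=
  ∃ Tn : ℕ → Ω → ℝ≥0∞, (∀ n, IsStoppingTimeM Λ (Tn n)) ∧
    P (⋃ n, {ω | Tn n ω = T ω ∧ T ω < ∞}) = P {ω | T ω < ∞}

/-- `T` is totally `Λ`-inaccessible. -/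
def IsTotallyInaccessibleM [mΩ2 : MeasurableSpace Ω] (P : Measure Ω)
    (Λ : MeasurableSpace (Ω × ℝ≥0)) (T : Ω → ℝ≥0∞) : Prop :=
  ∀ S, IsStoppingTimeM Λ S → P {ω | S ω = T ω ∧ T ω < ∞} = 0

/-- The σ-field `G_{T-}`: generated by `G_0` and the sets `A ∩ {t < T}`, `A ∈ G_t`. -/
def sigmaPre (G : ℝ≥0 → MeasurableSpace Ω) (T : Ω → ℝ≥0∞) : MeasurableSpace Ω :=
  MeasurableSpace.generateFrom
    ({A | MeasurableSet[G 0] A} ∪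
      {A | ∃ (t : ℝ≥0) (B : Set Ω), MeasurableSet[G t] B ∧ A = B ∩ {ω | (t : ℝ≥0∞) < T ω}})

/-- The σ-field `G_T` of a classical stopping time `T`. -/
def sigmaAtCl (G : ℝ≥0 → MeasurableSpace Ω) (T : Ω → ℝ≥0∞) : MeasurableSpace Ω :=
  MeasurableSpace.generateFrom
    {A | ∀ t : ℝ≥0, MeasurableSet[G t] (A ∩ {ω | T ω ≤ (t : ℝ≥0∞)})}

/-- A divided stopping time `σ = (T, W⁻, W, W⁺)`. -/
structure IsDividedST (Λ : MeasurableSpace (Ω × ℝ≥0)) (T : Ω → ℝ≥0∞)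
    (Wm W Wp : Set Ω) : Prop where
  stopping : IsStoppingTimeCl (FplusLambda Λ) T
  cover : Wm ∪ W ∪ Wp = Set.univ
  disj_mw : Wm ∩ W = ∅
  disj_mp : Wm ∩ Wp = ∅
  disj_wp : W ∩ Wp = ∅
  mem_m : MeasurableSet[sigmaPre (FplusLambda Λ) T] Wm
  m_pos : Wm ∩ {ω | T ω = 0} = ∅
  mem_w : MeasurableSet[sigmaAtTime Λ T] W
  mem_p : MeasurableSet[sigmaAtCl (FplusLambda Λ) T] Wp
  p_fin : Wp ∩ {ω | T ω = ∞} = ∅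
  pred_m : IsStoppingTimeM (predSF (FplusLambda Λ)) (restrictST T Wm)
  st_w : IsStoppingTimeM Λ (restrictST T W)

/-- The value `Z_σ` of a process at a divided stopping time. -/
def divEval (Z : Ω × ℝ≥0∞ → ℝ) (T : Ω → ℝ≥0∞) (Wm W Wp : Set Ω) : Ω → ℝ := fun ω =>
  if ω ∈ Wm then leftLimsup Z ω (T ω)
  else if ω ∈ W then Z (ω, T ω)
  else rightLimsup Z ω (T ω)

/-- `Zb` is the `Λ`-Snell envelope of the system `ZS`: a `Λ`-supermartingale which at
each `Λ`-stopping time `S` is (a version of) `ess sup_{T ∈ S^Λ, T ≥ S} E[Z(T) | F^Λ_S]`. -/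
def IsSnellSys (P : Measure Ω) (Λ : MeasurableSpace (Ω × ℝ≥0))
    (ZS : (Ω → ℝ≥0∞) → Ω → ℝ) (Zb : Ω × ℝ≥0∞ → ℝ) : Prop :=
  IsSupermartingaleM P Λ Zb ∧
  ∀ S, IsStoppingTimeM Λ S →
    (∀ T, IsStoppingTimeM Λ T → S ≤ T →
      P[ZS T|sigmaAtTime Λ S] ≤ᵐ[P] EvalAt Zb S) ∧
    ∀ U : Ω → ℝ,
      (∀ T, IsStoppingTimeM Λ T → S ≤ T → P[ZS T|sigmaAtTime Λ S] ≤ᵐ[P] U) →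
      EvalAt Zb S ≤ᵐ[P] U

/-- `Zb` is the `Λ`-Snell envelope of the process `Z`. -/
def IsSnellProc (P : Measure Ω) (Λ : MeasurableSpace (Ω × ℝ≥0))
    (Z Zb : Ω × ℝ≥0∞ → ℝ) : Prop :=
  IsSnellSys P Λ (fun S => EvalAt Z S) Zb

/-- An `S^Λ`-system. -/
def IsSystemM (P : Measure Ω) (Λ : MeasurableSpace (Ω × ℝ≥0))
    (ZS : (Ω → ℝ≥0∞) → Ω → ℝ) : Prop :=
  (∀ S T, IsStoppingTimeM Λ S → IsStoppingTimeM Λ T →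
    ∀ᵐ ω ∂P, S ω = T ω → ZS S ω = ZS T ω) ∧
  ∀ S, IsStoppingTimeM Λ S → Measurable[sigmaAtTime Λ S] (ZS S)

/-- An `S^Λ`-supermartingale system. -/
def IsSupermartingaleSystem (P : Measure Ω) (Λ : MeasurableSpace (Ω × ℝ≥0))
    (ZS : (Ω → ℝ≥0∞) → Ω → ℝ) : Prop :=
  IsSystemM P Λ ZS ∧ (∀ S, IsStoppingTimeM Λ S → Integrable (ZS S) P) ∧
  ∀ S T, IsStoppingTimeM Λ S → IsStoppingTimeM Λ T → S ≤ T →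
    P[ZS T|sigmaAtTime Λ S] ≤ᵐ[P] ZS S

/-- The process `Zb` aggregates the system `ZS`. -/
def Aggregates (P : Measure Ω) (Λ : MeasurableSpace (Ω × ℝ≥0))
    (Zb : Ω × ℝ≥0∞ → ℝ) (ZS : (Ω → ℝ≥0∞) → Ω → ℝ) : Prop :=
  ∀ S, IsStoppingTimeM Λ S → EvalAt Zb S =ᵐ[P] ZS S

/-- `pY` is the `F`-predictable projection of `Y` (with the convention `(^P Y)_∞ = 0`). -/
def IsPredProjE (P : Measure Ω) (G : ℝ≥0 → MeasurableSpace Ω)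
    (Y pY : Ω × ℝ≥0∞ → ℝ) : Prop :=
  MeasurableProcessE (predSF G) pY ∧ (∀ ω, pY (ω, ∞) = 0) ∧
  ∀ S, IsStoppingTimeM (predSF G) S → (∀ ω, S ω < ∞) →
    EvalAt pY S =ᵐ[P] P[EvalAt Y S|sigmaAtTime (predSF G) S]

/-! ### A measurable selection lemma -/

lemma exists_compact_pos {X : Type*} [TopologicalSpace X] [T2Space X] [MeasurableSpace X]
    [BorelSpace X] (ν : Measure X) [ν.OuterRegular] (h : (ℕ → ℕ) → X) (hh : Continuous h)
    (hpos : ν (range h) ≠ 0) :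
    ∃ K : Set (ℕ → ℕ), IsCompact K ∧ ν (h '' K) ≠ 0 := by
  obtain ⟨δ, hδ0, hδ⟩ := exists_between (pos_iff_ne_zero.2 hpos)
  let S := {C : Set (ℕ → ℕ) // δ < ν (h '' C)}
  have step : ∀ (k : ℕ) (C : S), ∃ m : ℕ, δ < ν (h '' (C.1 ∩ {x | x k ≤ m})) := by
    intro k C
    have hU : h '' C.1 = ⋃ m : ℕ, h '' (C.1 ∩ {x | x k ≤ m}) := by
      rw [← image_iUnion, ← inter_iUnion]
      congr 1
      ext x
      simp only [mem_inter_iff, mem_iUnion, mem_ofPred_eq]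
      exact ⟨fun hx => ⟨hx, x k, le_rfl⟩, fun hx => hx.1⟩
    have hm : Monotone fun m : ℕ => h '' (C.1 ∩ {x | x k ≤ m}) := by
      intro a b hab
      apply image_mono
      apply inter_subset_inter_right
      intro x hx
      exact le_trans hx hab
    have := C.2
    rw [hU, hm.measure_iUnion] at this
    exact lt_iSup_iff.1 this
  choose m hm using step
  let F : ℕ → S := fun k => Nat.rec ⟨univ, by simpa using hδ⟩
    (fun k C => ⟨C.1 ∩ {x | x k ≤ m k C}, hm k C⟩) k
  let n : ℕ → ℕ := fun k => m k (F k)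
  have hF : ∀ k, (F k).1 = {x | ∀ i < k, x i ≤ n i} := by
    intro k
    induction k with
    | zero => simp [F]
    | succ k ih =>
      have : (F (k+1)).1 = (F k).1 ∩ {x | x k ≤ n k} := rfl
      rw [this, ih]
      ext x
      simp only [mem_inter_iff, mem_ofPred_eq, Nat.lt_succ_iff_lt_or_eq]
      constructor
      · rintro ⟨h1, h2⟩ i (hi | rfl)
        · exact h1 i hi
        · exact h2
      · intro h1
        exact ⟨fun i hi => h1 i (Or.inl hi), h1 k (Or.inr rfl)⟩
  have hKc : IsCompact (Set.pi univ fun i => Iic (n i)) :=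
    isCompact_univ_pi fun i => (Set.finite_Iic (n i)).isCompact
  refine ⟨Set.pi univ fun i => Iic (n i), hKc, ?_⟩
  intro h0
  obtain ⟨U, hKU, hUo, hUδ⟩ := Set.exists_isOpen_lt_of_lt _ δ (h0 ▸ hδ0)
  have key : ∀ k, ∃ y ∈ (F k).1, h y ∉ U := by
    intro k
    by_contra! hc
    have : h '' (F k).1 ⊆ U := by
      rintro _ ⟨y, hy, rfl⟩
      exact hc y hy
    exact absurd ((F k).2.trans_le (measure_mono this)) (not_lt.2 hUδ.le)
  choose y hy hyU using key
  let z : ℕ → ℕ → ℕ := fun k i => if i < k then y k i else 0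
  have hz : ∀ k, z k ∈ Set.pi univ fun i => Iic (n i) := by
    intro k i _
    have := hy k
    rw [hF] at this
    simp only [z, mem_Iic]
    split_ifs with hi
    · exact this i hi
    · exact Nat.zero_le _
  obtain ⟨a, ha, φ, hφ, hlim⟩ := hKc.tendsto_subseq hz
  have hlim' : Tendsto (fun j => y (φ j)) atTop (𝓝 a) := by
    rw [tendsto_pi_nhds] at hlim ⊢
    intro i
    refine (hlim i).congr' ?_
    filter_upwards [eventually_gt_atTop i] with j hj
    simp only [Function.comp, z]
    rw [if_pos (hj.trans_le (hφ.id_le j))]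
  have haU : h a ∈ U := hKU ⟨a, ha, rfl⟩
  have := ((hh.tendsto a).comp hlim').eventually (hUo.mem_nhds haU)
  obtain ⟨j, hj⟩ := this.exists
  exact hyU _ hj

lemma exists_section_polish {X : Type*} [TopologicalSpace X] [PolishSpace X] [MeasurableSpace X]
    [BorelSpace X] (ν : Measure X) [IsFiniteMeasure ν] (A : Set (X × ℝ≥0)) (hA : MeasurableSet A)
    (hpos : ν (Prod.fst '' A) ≠ 0) :
    ∃ (W : Set X) (R : X → ℝ≥0), MeasurableSet W ∧ Measurable R ∧ ν W ≠ 0 ∧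
      ∀ x ∈ W, (x, R x) ∈ A := by
  let := TopologicalSpace.upgradeIsCompletelyMetrizable X
  have hA' : AnalyticSet A := hA.analyticSet
  rw [AnalyticSet] at hA'
  rcases hA' with rfl | ⟨g, hg, rfl⟩
  · simp at hpos
  rw [← range_comp] at hpos
  obtain ⟨K, hK, hKpos⟩ := exists_compact_pos ν (Prod.fst ∘ g) (continuous_fst.comp hg) hpos
  rw [image_comp] at hKpos
  have hK' : IsCompact (g '' K) := hK.image hg
  set L := g '' K with hL
  have hsec : ∀ x, x ∈ Prod.fst '' L → (x, sInf {t | (x, t) ∈ L}) ∈ L := by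
    intro x hx
    have hne : {t : ℝ≥0 | (x, t) ∈ L}.Nonempty := by
      obtain ⟨⟨a, t⟩, h1, rfl⟩ := hx
      exact ⟨t, h1⟩
    have hcl : IsClosed {t : ℝ≥0 | (x, t) ∈ L} :=
      hK'.isClosed.preimage (f := fun t : ℝ≥0 => (x, t)) (by fun_prop)
    exact hcl.csInf_mem hne (OrderBot.bddBelow _)
  have hW : MeasurableSet (Prod.fst '' L) := (hK'.image continuous_fst).isClosed.measurableSet
  refine ⟨Prod.fst '' L, fun x => sInf {t | (x, t) ∈ L}, hW, ?_, hKpos, ?_⟩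
  · apply measurable_of_Iic
    intro t
    have : (fun x => sInf {t | (x, t) ∈ L}) ⁻¹' Iic t
        = (Prod.fst '' L)ᶜ ∪ Prod.fst '' (L ∩ Prod.snd ⁻¹' Iic t) := by
      ext x
      simp only [mem_preimage, mem_Iic, mem_union, mem_compl_iff]
      constructor
      · intro h
        by_cases hx : x ∈ Prod.fst '' L
        · exact Or.inr ⟨_, ⟨hsec x hx, h⟩, rfl⟩
        · exact Or.inl hx
      · rintro (h | ⟨⟨a, s⟩, ⟨h1, h2⟩, rfl⟩)
        · have : {t : ℝ≥0 | (x, t) ∈ L} = ∅ := by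
            ext s
            simp only [mem_ofPred_eq, mem_empty_iff_false, iff_false]
            intro hs
            exact h ⟨_, hs, rfl⟩
          rw [this]
          simp
        · exact (csInf_le (OrderBot.bddBelow {t : ℝ≥0 | (a, t) ∈ L}) h1).trans h2
    rw [this]
    refine hW.compl.union (IsClosed.measurableSet ?_)
    exact ((hK'.inter_right (isClosed_Iic.preimage continuous_snd)).image continuous_fst).isClosed
  · intro x hx
    exact image_subset_range _ _ (hsec x hx)

lemma exists_factor (A : Set (Ω × ℝ≥0)) (hA : MeasurableSet A) :
    ∃ (f : Ω → ℕ → Bool) (A' : Set ((ℕ → Bool) × ℝ≥0)), Measurable f ∧ MeasurableSet A' ∧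
      A = (fun p : Ω × ℝ≥0 => (f p.1, p.2)) ⁻¹' A' := by
  induction A, hA using MeasurableSpace.induction_on_inter generateFrom_prod.symm
    isPiSystem_prod with
  | empty => exact ⟨fun _ _ => true, ∅, measurable_const, MeasurableSet.empty, rfl⟩
  | basic t ht =>
    obtain ⟨s, hs, u, hu, rfl⟩ := ht
    refine ⟨fun ω _ => decide (ω ∈ s), {x | x 0 = true} ×ˢ u, ?_, ?_, ?_⟩
    · refine measurable_pi_iff.2 fun _ => ?_
      refine measurable_to_bool ?_
      have : (fun ω => decide (ω ∈ s)) ⁻¹' {true} = s := by ext; simp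
      rw [this]
      exact hs
    · refine MeasurableSet.prod ?_ hu
      exact (measurable_pi_apply (X := fun _ : ℕ => Bool) 0) (measurableSet_singleton true)
    · ext ⟨ω, t⟩
      simp
  | compl t _ ih =>
    obtain ⟨f, A', hf, hA', rfl⟩ := ih
    exact ⟨f, A'ᶜ, hf, hA'.compl, rfl⟩
  | iUnion F _ _ ih =>
    choose f A' hf hA' hFA using ih
    refine ⟨fun ω k => f k.unpair.1 ω k.unpair.2,
      ⋃ n, (fun q : (ℕ → Bool) × ℝ≥0 => ((fun j => q.1 (Nat.pair n j)), q.2)) ⁻¹' A' n, ?_, ?_, ?_⟩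
    · refine measurable_pi_iff.2 fun k => ?_
      exact (measurable_pi_apply _).comp (hf _)
    · refine MeasurableSet.iUnion fun n => ?_
      refine Measurable.prodMk ?_ measurable_snd (hA' n)
      exact measurable_pi_iff.2 fun j => (measurable_pi_apply _).comp measurable_fst
    · rw [preimage_iUnion]
      refine iUnion_congr fun n => ?_
      rw [hFA n]
      ext ⟨ω, t⟩
      simp

lemma exists_section (P : Measure Ω) [IsFiniteMeasure P] (A : Set (Ω × ℝ≥0))
    (hA : MeasurableSet A) (hpos : P (Prod.fst '' A) ≠ 0) :
    ∃ (W : Set Ω) (R : Ω → ℝ≥0), MeasurableSet W ∧ Measurable R ∧ P W ≠ 0 ∧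
      ∀ x ∈ W, (x, R x) ∈ A := by
  obtain ⟨f, A', hf, hA', rfl⟩ := exists_factor A hA
  have hsub : Prod.fst '' ((fun p : Ω × ℝ≥0 => (f p.1, p.2)) ⁻¹' A') ⊆ f ⁻¹' (Prod.fst '' A') := by
    rintro _ ⟨⟨ω, t⟩, h, rfl⟩
    exact ⟨_, h, rfl⟩
  have h1 : P.map f (Prod.fst '' A') ≠ 0 := by
    intro h0
    apply hpos
    refine measure_mono_null hsub ?_
    exact le_antisymm ((Measure.le_map_apply hf.aemeasurable _).trans h0.le) zero_le
  have : PolishSpace (ℕ → Bool) := PolishSpace.mk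
  obtain ⟨W, R, hW, hR, hWp, hWR⟩ := exists_section_polish (P.map f) A' hA' h1
  refine ⟨f ⁻¹' W, R ∘ f, hf hW, hR.comp hf, ?_, fun x hx => hWR _ hx⟩
  rwa [Measure.map_apply hf hW] at hWp

/-! ### Inner approximation -/

/-- A right-continuous `Λ`-measurable process. -/
def IsRC (Λ : MeasurableSpace (Ω × ℝ≥0)) (Y : Ω × ℝ≥0 → ℝ) : Prop :=
  Measurable[Λ] Y ∧ ∀ ω t, Tendsto (fun s => Y (ω, s)) (𝓝[≥] t) (𝓝 (Y (ω, t)))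

/-- Countable intersections of sets `{Y ≥ 0}`, `Y` right-continuous and `Λ`-measurable. -/
def IsJd (Λ : MeasurableSpace (Ω × ℝ≥0)) (B : Set (Ω × ℝ≥0)) : Prop :=
  ∃ Y : ℕ → Ω × ℝ≥0 → ℝ, (∀ n, IsRC Λ (Y n)) ∧ B = {p | ∀ n, 0 ≤ Y n p}

lemma IsJd.union {Λ : MeasurableSpace (Ω × ℝ≥0)} {B C : Set (Ω × ℝ≥0)}
    (hB : IsJd Λ B) (hC : IsJd Λ C) : IsJd Λ (B ∪ C) := by
  obtain ⟨Y, hY, rfl⟩ := hB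
  obtain ⟨X, hX, rfl⟩ := hC
  refine ⟨fun k p => max (Y k.unpair.1 p) (X k.unpair.2 p), fun k => ⟨?_, fun ω t => ?_⟩, ?_⟩
  · exact (hY _).1.max (hX _).1
  · exact ((hY _).2 ω t).max ((hX _).2 ω t)
  · ext p
    simp only [mem_union, mem_ofPred_eq, le_max_iff]
    constructor
    · rintro (h | h) k
      · exact Or.inl (h _)
      · exact Or.inr (h _)
    · intro h
      by_contra! hc
      obtain ⟨⟨a, ha⟩, ⟨b, hb⟩⟩ := hc
      have := h (Nat.pair a b)
      simp only [Nat.unpair_pair] at this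
      rcases this with h | h <;> linarith

lemma IsJd.iInter {Λ : MeasurableSpace (Ω × ℝ≥0)} {B : ℕ → Set (Ω × ℝ≥0)}
    (hB : ∀ n, IsJd Λ (B n)) : IsJd Λ (⋂ n, B n) := by
  choose Y hY hB using hB
  refine ⟨fun k => Y k.unpair.1 k.unpair.2, fun k => hY _ _, ?_⟩
  ext p
  simp only [hB, mem_iInter, mem_ofPred_eq]
  refine ⟨fun h k => h _ _, fun h a b => ?_⟩
  simpa using h (Nat.pair a b)

lemma IsJd.of_rc {Λ : MeasurableSpace (Ω × ℝ≥0)} {Y : Ω × ℝ≥0 → ℝ} (hY : IsRC Λ Y) :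
    IsJd Λ {p | 0 ≤ Y p} :=
  ⟨fun _ => Y, fun _ => hY, by simp⟩

lemma IsJd.empty {Λ : MeasurableSpace (Ω × ℝ≥0)} : IsJd Λ ∅ := by
  have : IsRC Λ (fun _ : Ω × ℝ≥0 => (-1 : ℝ)) :=
    ⟨measurable_const, fun _ _ => tendsto_const_nhds⟩
  convert IsJd.of_rc this using 1
  ext p
  simp only [mem_empty_iff_false, mem_ofPred_eq, false_iff]
  norm_num

lemma IsJd.measurableSet {Λ : MeasurableSpace (Ω × ℝ≥0)} {B : Set (Ω × ℝ≥0)}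
    (hB : IsJd Λ B) : MeasurableSet[Λ] B := by
  obtain ⟨Y, hY, rfl⟩ := hB
  rw [ofPred_forall]
  exact MeasurableSet.iInter fun n => (hY n).1 measurableSet_Ici

/-- Inner approximability. -/
def InnerQ (Λ : MeasurableSpace (Ω × ℝ≥0)) (μ : Measure (Ω × ℝ≥0)) (A : Set (Ω × ℝ≥0)) : Prop :=
  ∀ ε : ℝ≥0∞, ε ≠ 0 → ∃ B, IsJd Λ B ∧ B ⊆ A ∧ μ (A \ B) ≤ ε

lemma InnerQ.iInter {Λ : MeasurableSpace (Ω × ℝ≥0)} {μ : Measure (Ω × ℝ≥0)}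
    {A : ℕ → Set (Ω × ℝ≥0)} (hA : ∀ n, InnerQ Λ μ (A n)) : InnerQ Λ μ (⋂ n, A n) := by
  intro ε hε
  obtain ⟨e, he, hes⟩ := ENNReal.exists_pos_sum_of_countable' hε ℕ
  choose B hB hBA hμ using fun n => hA n (e n) (he n).ne'
  refine ⟨⋂ n, B n, IsJd.iInter hB, iInter_mono hBA, ?_⟩
  have : (⋂ n, A n) \ (⋂ n, B n) ⊆ ⋃ n, (A n \ B n) := by
    rintro p ⟨h1, h2⟩
    simp only [mem_iInter, not_forall, mem_iUnion, Set.mem_sdiff] at *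
    obtain ⟨n, hn⟩ := h2
    exact ⟨n, h1 n, hn⟩
  calc _ ≤ _ := measure_mono this
    _ ≤ _ := measure_iUnion_le _
    _ ≤ ∑' n, e n := ENNReal.tsum_le_tsum hμ
    _ ≤ ε := hes.le

lemma InnerQ.iUnion {Λ : MeasurableSpace (Ω × ℝ≥0)} {μ : Measure (Ω × ℝ≥0)} [IsFiniteMeasure μ]
    {A : ℕ → Set (Ω × ℝ≥0)} (hA : ∀ n, InnerQ Λ μ (A n)) : InnerQ Λ μ (⋃ n, A n) := by
  intro ε hε
  have hε2 : ε / 2 ≠ 0 := (ENNReal.half_pos hε).ne'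
  obtain ⟨e, he, hes⟩ := ENNReal.exists_pos_sum_of_countable' hε2 ℕ
  choose B hB hBA hμ using fun n => hA n (e n) (he n).ne'
  let C : ℕ → Set (Ω × ℝ≥0) := fun N => ⋃ n < N, B n
  have hCs : ∀ N, C (N+1) = C N ∪ B N := fun N => biUnion_lt_succ B N
  have hCJ : ∀ N, IsJd Λ (C N) := by
    intro N
    induction N with
    | zero => simpa [C] using IsJd.empty
    | succ N ih => rw [hCs]; exact ih.union (hB N)
  have hCm : Monotone C := by
    refine monotone_nat_of_le_succ fun N => ?_
    rw [hCs]
    exact subset_union_left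
  have hCB : ⋃ N, C N = ⋃ n, B n := by
    ext p
    simp only [C, mem_iUnion]
    constructor
    · rintro ⟨N, n, _, h⟩
      exact ⟨n, h⟩
    · rintro ⟨n, h⟩
      exact ⟨n+1, n, Nat.lt_succ_self n, h⟩
  have hBm : MeasurableSet (⋃ n, B n) :=
    MeasurableSet.iUnion fun n => (hB n).measurableSet
  have hlim : Tendsto (fun N => μ ((⋃ n, B n) \ C N)) atTop (𝓝 0) := by
    have h0 : ⋂ N, ((⋃ n, B n) \ C N) = ∅ := by
      rw [← sdiff_iUnion, hCB, Set.sdiff_self]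
    rw [← measure_empty (μ := μ), ← h0]
    refine tendsto_measure_iInter_atTop (fun N => ?_) ?_ ⟨0, measure_ne_top _ _⟩
    · exact (hBm.diff (hCJ N).measurableSet).nullMeasurableSet
    · intro a b hab
      exact sdiff_subset_sdiff_right (hCm hab)
  obtain ⟨N, hN⟩ := (hlim.eventually (gt_mem_nhds (pos_iff_ne_zero.2 hε2))).exists
  refine ⟨C N, hCJ N, ?_, ?_⟩
  · exact (subset_iUnion C N).trans (hCB.subset.trans (iUnion_mono hBA))
  · have hsub : (⋃ n, A n) \ C N ⊆ (⋃ n, (A n \ B n)) ∪ ((⋃ n, B n) \ C N) := by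
      rintro p ⟨h1, h2⟩
      obtain ⟨n, hn⟩ := mem_iUnion.1 h1
      by_cases hp : p ∈ B n
      · exact Or.inr ⟨mem_iUnion.2 ⟨n, hp⟩, h2⟩
      · exact Or.inl (mem_iUnion.2 ⟨n, hn, hp⟩)
    calc _ ≤ _ := measure_mono hsub
      _ ≤ _ := measure_union_le _ _
      _ ≤ ε / 2 + ε / 2 := by
        refine add_le_add ?_ hN.le
        calc _ ≤ _ := measure_iUnion_le _
          _ ≤ ∑' n, e n := ENNReal.tsum_le_tsum hμ
          _ ≤ _ := hes.le
      _ = ε := ENNReal.add_halves ε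

lemma innerQ_of_measurable {Λ : MeasurableSpace (Ω × ℝ≥0)} {μ : Measure (Ω × ℝ≥0)}
    [IsFiniteMeasure μ] (hΛ : IsMeyer mΩ Λ) {A : Set (Ω × ℝ≥0)} (hA : MeasurableSet[Λ] A) :
    InnerQ Λ μ A := by
  obtain ⟨C, hC, hgen⟩ := hΛ.gen_cadlag
  have hself : ∀ B, IsJd Λ B → InnerQ Λ μ B := fun B hB ε _ => ⟨B, hB, Subset.rfl, by simp⟩
  let 𝓐 : MeasurableSpace (Ω × ℝ≥0) :=
    { MeasurableSet' := fun A => InnerQ Λ μ A ∧ InnerQ Λ μ Aᶜ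
      measurableSet_empty := by
        refine ⟨hself _ IsJd.empty, hself _ ?_⟩
        have : IsRC Λ (fun _ : Ω × ℝ≥0 => (1 : ℝ)) :=
          ⟨measurable_const, fun _ _ => tendsto_const_nhds⟩
        convert IsJd.of_rc this using 1
        ext p
        simp
      measurableSet_compl := fun s hs => ⟨hs.2, by rw [compl_compl]; exact hs.1⟩
      measurableSet_iUnion := fun f hf => by
        refine ⟨InnerQ.iUnion fun n => (hf n).1, ?_⟩
        rw [compl_iUnion]
        exact InnerQ.iInter fun n => (hf n).2 }
  have hle : Λ ≤ 𝓐 := by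
    rw [hgen]
    refine iSup₂_le fun f hf => ?_
    rw [← measurable_iff_comap_le]
    have hfm : Measurable[Λ] f := by
      rw [measurable_iff_comap_le, hgen]
      exact le_iSup₂_of_le f hf le_rfl
    have hrc : ∀ ω t, Tendsto (fun s => f (ω, s)) (𝓝[≥] t) (𝓝 (f (ω, t))) :=
      fun ω t => (hC f hf ω).1 t
    refine @measurable_of_Ici _ _ _ _ _ 𝓐 _ _ _ f fun c => ?_
    constructor
    · have : IsRC Λ (fun p => f p - c) := ⟨hfm.sub_const c, fun ω t => (hrc ω t).sub_const c⟩
      convert hself _ (IsJd.of_rc this) using 1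
      ext p
      simp
    · have : (f ⁻¹' Ici c)ᶜ = ⋃ n : ℕ, {p | 0 ≤ c - 1 / ((n : ℝ) + 1) - f p} := by
        ext p
        simp only [mem_compl_iff, mem_preimage, mem_Ici, not_le, mem_iUnion, mem_ofPred_eq]
        constructor
        · intro h
          obtain ⟨n, hn⟩ := exists_nat_one_div_lt (sub_pos.2 h)
          exact ⟨n, by linarith⟩
        · rintro ⟨n, hn⟩
          have : (0 : ℝ) < 1 / ((n : ℝ) + 1) := by positivity
          linarith
      rw [this]
      refine InnerQ.iUnion fun n => hself _ (IsJd.of_rc ⟨?_, fun ω t => ?_⟩)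
      · exact hfm.const_sub _
      · exact (hrc ω t).const_sub _
  exact (hle _ hA).1

/-! ### Stopping times -/

lemma iInf_coe_le_iff (E : Set ℝ≥0) (hup : ∀ s ∈ E, ∀ t, s ≤ t → t ∈ E)
    (hrc : ∀ t, (∀ u, t < u → u ∈ E) → t ∈ E) (t : ℝ≥0) :
    (⨅ s ∈ E, (s : ℝ≥0∞)) ≤ (t : ℝ≥0∞) ↔ t ∈ E := by
  constructor
  · intro h
    refine hrc t fun u hu => ?_
    have : (⨅ s ∈ E, (s : ℝ≥0∞)) < (u : ℝ≥0∞) := h.trans_lt (by exact_mod_cast hu)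
    simp only [iInf_lt_iff] at this
    obtain ⟨s, hs, hsu⟩ := this
    exact hup s hs u (by exact_mod_cast hsu.le)
  · intro h
    exact iInf₂_le t h

lemma measurableSet_stopped {Λ : MeasurableSpace (Ω × ℝ≥0)} (hΛ : IsMeyer mΩ Λ) {G : Set (Ω × ℝ≥0)}
    (hG : MeasurableSet[Λ] G) (q : ℝ≥0) :
    MeasurableSet[Λ] {p : Ω × ℝ≥0 | (p.1, min p.2 q) ∈ G} := by
  have h1 : Measurable[Λ] (G.indicator (fun _ => (1 : ℝ))) := measurable_const.indicator hG
  have h2 := hΛ.stop_stable _ h1 q (measurableSet_singleton (1 : ℝ))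
  convert h2 using 1
  ext p
  simp [indicator]

lemma next_time {Λ : MeasurableSpace (Ω × ℝ≥0)} (hΛ : IsMeyer mΩ Λ) {T : Ω → ℝ≥0∞}
    (hT : IsStoppingTimeM Λ T) {Y : Ω × ℝ≥0 → ℝ} (hY : IsRC Λ Y) :
    ∃ T' : Ω → ℝ≥0∞, IsStoppingTimeM Λ T' ∧ T ≤ T' ∧
      (∀ ω (t : ℝ≥0), T ω ≤ t → 0 ≤ Y (ω, t) → T' ω ≤ t) ∧
      ∀ ω (t : ℝ≥0), T' ω = T ω → T ω = t → 0 ≤ Y (ω, t) := by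
  let H : Ω → Set ℝ≥0 := fun ω =>
    {t | ∀ k : ℕ, ∃ s ≤ t, T ω ≤ (s : ℝ≥0∞) ∧ -(1 / ((k : ℝ) + 1)) < Y (ω, s)}
  have hup : ∀ ω, ∀ s ∈ H ω, ∀ t, s ≤ t → t ∈ H ω := by
    intro ω s hs t hst k
    obtain ⟨r, hr, h⟩ := hs k
    exact ⟨r, hr.trans hst, h⟩
  have hrc : ∀ ω, ∀ t, (∀ u, t < u → u ∈ H ω) → t ∈ H ω := by
    intro ω t h k
    by_contra! hc
    have hTt : T ω ≤ t := by
      refine le_of_forall_gt fun a ha => ?_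
      obtain ⟨b, hb1, hb2⟩ := ENNReal.lt_iff_exists_nnreal_btwn.1 ha
      obtain ⟨s, hs, hTs, _⟩ := h b (by exact_mod_cast hb1) 0
      exact (hTs.trans (by exact_mod_cast hs)).trans_lt hb2
    have hYt : Y (ω, t) ≤ -(1 / ((k : ℝ) + 1)) := hc t le_rfl hTt
    have hlt : -(1 / ((k : ℝ) + 1)) < -(1 / (((k + 1 : ℕ) : ℝ) + 1)) := by
      push_cast
      apply neg_lt_neg
      apply one_div_lt_one_div_of_lt <;> [positivity; linarith]
    have hev := (hY.2 ω t).eventually (gt_mem_nhds (hYt.trans_lt hlt))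
    obtain ⟨u, hu, hsub⟩ := (mem_nhdsGE_iff_exists_Ico_subset).1 hev
    obtain ⟨v, hv1, hv2⟩ := exists_between (show t < u from hu)
    obtain ⟨s, hs, hTs, hYs⟩ := h v hv1 (k + 1)
    rcases le_or_gt s t with hst | hst
    · have := hc s hst hTs
      linarith
    · have : Y (ω, s) < -(1 / (((k + 1 : ℕ) : ℝ) + 1)) := hsub ⟨hst.le, hs.trans_lt hv2⟩
      linarith
  have hle : ∀ ω (t : ℝ≥0), (⨅ s ∈ H ω, (s : ℝ≥0∞)) ≤ (t : ℝ≥0∞) ↔ t ∈ H ω :=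
    fun ω t => iInf_coe_le_iff (H ω) (hup ω) (hrc ω) t
  refine ⟨fun ω => ⨅ s ∈ H ω, (s : ℝ≥0∞), ?_, ?_, ?_, ?_⟩
  · unfold IsStoppingTimeM
    let G : ℕ → Set (Ω × ℝ≥0) := fun k =>
      {p | T p.1 ≤ (p.2 : ℝ≥0∞)} ∩ Y ⁻¹' Ioi (-(1 / ((k : ℝ) + 1)))
    have hG : ∀ k, MeasurableSet[Λ] (G k) := fun k =>
      MeasurableSet.inter hT (hY.1 measurableSet_Ioi)
    have heq : {p : Ω × ℝ≥0 | (⨅ s ∈ H p.1, (s : ℝ≥0∞)) ≤ (p.2 : ℝ≥0∞)} =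
        ⋂ k, (G k ∪ ⋃ n : ℕ, {p | (p.1, min p.2 (TopologicalSpace.denseSeq ℝ≥0 n)) ∈ G k}) := by
      ext ⟨ω, t⟩
      rw [mem_ofPred_eq, hle]
      simp only [mem_iInter, mem_union, mem_iUnion, mem_ofPred_eq]
      refine forall_congr' fun k => ?_
      constructor
      · rintro ⟨s, hst, hTs, hYs⟩
        rcases hst.eq_or_lt with rfl | hst
        · exact Or.inl ⟨hTs, hYs⟩
        · right
          have hev := (hY.2 ω s).eventually (lt_mem_nhds hYs)
          obtain ⟨u, hu, hsub⟩ := (mem_nhdsGE_iff_exists_Ico_subset).1 hev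
          obtain ⟨_, ⟨n, rfl⟩, h1, h2⟩ := (TopologicalSpace.denseRange_denseSeq ℝ≥0).exists_between
            (lt_min (show s < u from hu) hst)
          refine ⟨n, ?_⟩
          rw [min_eq_right (h2.le.trans (min_le_right _ _))]
          refine ⟨hTs.trans ?_, hsub ⟨h1.le, h2.trans_le (min_le_left _ _)⟩⟩
          exact_mod_cast h1.le
      · rintro (⟨h1, h2⟩ | ⟨n, h1, h2⟩)
        · exact ⟨t, le_rfl, h1, h2⟩
        · exact ⟨_, min_le_left _ _, h1, h2⟩
    rw [heq]
    exact MeasurableSet.iInter fun k =>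
      (hG k).union (MeasurableSet.iUnion fun n => measurableSet_stopped hΛ (hG k) _)
  · intro ω
    refine le_iInf₂ fun s hs => ?_
    obtain ⟨r, hr, h, _⟩ := hs 0
    exact h.trans (by exact_mod_cast hr)
  · intro ω t hTt hYt
    rw [hle]
    intro k
    refine ⟨t, le_rfl, hTt, lt_of_lt_of_le ?_ hYt⟩
    have : (0 : ℝ) < 1 / ((k : ℝ) + 1) := by positivity
    linarith
  · intro ω t h1 h2
    have ht : t ∈ H ω := by
      rw [← hle]
      exact (h1.trans h2).le
    by_contra! hneg
    obtain ⟨k, hk⟩ := exists_nat_one_div_lt (neg_pos.2 hneg)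
    obtain ⟨s, hst, hTs, hYs⟩ := ht k
    rw [h2] at hTs
    have : s = t := le_antisymm hst (by exact_mod_cast hTs)
    subst this
    linarith

lemma st_measurable {Λ : MeasurableSpace (Ω × ℝ≥0)} (hΛ : IsMeyer mΩ Λ) {T : Ω → ℝ≥0∞}
    (hT : IsStoppingTimeM Λ T) : Measurable T := by
  have hfin : ∀ t : ℝ≥0, MeasurableSet {ω | T ω ≤ (t : ℝ≥0∞)} := by
    intro t
    have h1 := hΛ.le_prod _ hT
    exact measurable_prodMk_right (y := t) h1
  apply measurable_of_Iic
  intro x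
  induction x with
  | top => simp
  | coe x => exact hfin x

lemma exists_max_time {Λ : MeasurableSpace (Ω × ℝ≥0)} (hΛ : IsMeyer mΩ Λ) (P : Measure Ω)
    [IsFiniteMeasure P] (D : Ω → ℝ≥0∞) :
    ∃ T, IsStoppingTimeM Λ T ∧ T ≤ D ∧
      ∀ T', IsStoppingTimeM Λ T' → T ≤ T' → T' ≤ D → T' =ᵐ[P] T := by
  let S := {T : Ω → ℝ≥0∞ | IsStoppingTimeM Λ T ∧ T ≤ D}
  let I : (Ω → ℝ≥0∞) → ℝ≥0∞ := fun T => ∫⁻ ω, (1 + T ω)⁻¹ ∂P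
  have hne : (I '' S).Nonempty := by
    refine ⟨_, fun _ => 0, ⟨?_, fun ω => zero_le⟩, rfl⟩
    unfold IsStoppingTimeM
    simp
  have hanti : ∀ T T' : Ω → ℝ≥0∞, T ≤ T' → ∀ ω, (1 + T' ω)⁻¹ ≤ (1 + T ω)⁻¹ := by
    intro T T' h ω
    exact ENNReal.inv_le_inv.2 (add_le_add le_rfl (h ω))
  obtain ⟨u, -, hulim, humem⟩ := exists_seq_tendsto_sInf hne (OrderBot.bddBelow _)
  choose T hTS hTu using humem
  have hsupS : (fun ω => ⨆ n, T n ω) ∈ S := by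
    refine ⟨?_, fun ω => iSup_le fun n => (hTS n).2 ω⟩
    unfold IsStoppingTimeM
    simp only [iSup_le_iff, ofPred_forall]
    exact MeasurableSet.iInter fun n => (hTS n).1
  refine ⟨_, hsupS.1, hsupS.2, fun T' hT' hle hD => ?_⟩
  have h1 : I (fun ω => ⨆ n, T n ω) ≤ sInf (I '' S) := by
    refine ge_of_tendsto' hulim fun n => ?_
    rw [← hTu n]
    exact lintegral_mono (hanti _ _ fun ω => le_iSup (fun n => T n ω) n)
  have h2 : I (fun ω => ⨆ n, T n ω) ≤ I T' := h1.trans (sInf_le ⟨T', ⟨hT', hD⟩, rfl⟩)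
  have hfin : I T' ≠ ∞ := by
    refine ne_top_of_le_ne_top (measure_ne_top P univ) ?_
    calc I T' ≤ ∫⁻ _, 1 ∂P := by
          refine lintegral_mono fun ω => ?_
          rw [ENNReal.inv_le_one]
          exact le_self_add
      _ = _ := by simp
  have hm : AEMeasurable (fun ω => (1 + ⨆ n, T n ω)⁻¹) P :=
    ((st_measurable hΛ hsupS.1).const_add 1).inv.aemeasurable
  have := ae_eq_of_ae_le_of_lintegral_le (ae_of_all P (hanti _ _ hle)) hfin hm h2
  filter_upwards [this] with ω hω
  have := inv_injective hω
  exact (ENNReal.add_right_inj ENNReal.one_ne_top).1 this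

lemma main_le (P : Measure Ω) [IsFiniteMeasure P]
    (Λ : MeasurableSpace (Ω × ℝ≥0)) (hΛ : IsMeyer mΩ Λ)
    (Z Z' : Ω × ℝ≥0 → ℝ) (hZ : Measurable[Λ] Z) (hZ' : Measurable[Λ] Z')
    (h : ∀ T : Ω → ℝ≥0∞, IsStoppingTimeM Λ T → (∃ C : ℝ≥0, ∀ ω, T ω ≤ (C : ℝ≥0∞)) →
        EvalAtF Z T ≤ᵐ[P] EvalAtF Z' T) :
    P {ω | ∃ t : ℝ≥0, Z' (ω, t) < Z (ω, t)} = 0 := by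
  let A : ℕ → Set (Ω × ℝ≥0) := fun N => {p | Z' p < Z p} ∩ (univ ×ˢ Iic (N : ℝ≥0))
  have hA : ∀ N, MeasurableSet[Λ] (A N) := fun N =>
    MeasurableSet.inter (measurableSet_lt hZ' hZ) (hΛ.contains_borel _ measurableSet_Iic)
  have hU : {ω | ∃ t : ℝ≥0, Z' (ω, t) < Z (ω, t)} ⊆ ⋃ N, Prod.fst '' A N := by
    rintro ω ⟨t, ht⟩
    obtain ⟨N, hN⟩ := exists_nat_ge t
    exact mem_iUnion.2 ⟨N, (ω, t), ⟨ht, mem_univ _, hN⟩, rfl⟩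
  refine measure_mono_null hU (measure_iUnion_null fun N => ?_)
  by_contra hpos
  obtain ⟨W, R, hW, hR, hWp, hWR⟩ := exists_section P (A N) (hΛ.le_prod _ (hA N)) hpos
  have hι : @Measurable Ω (Ω × ℝ≥0) mΩ Λ (fun ω => (ω, R ω)) :=
    (measurable_id.prodMk hR).mono le_rfl hΛ.le_prod
  let μ : @Measure (Ω × ℝ≥0) Λ := @Measure.map _ _ mΩ Λ (fun ω => (ω, R ω)) (P.restrict W)
  have hμ : ∀ B, MeasurableSet[Λ] B → μ B = P ({ω | (ω, R ω) ∈ B} ∩ W) := by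
    intro B hB
    rw [Measure.map_apply hι hB, Measure.restrict_apply (hι hB)]
    rfl
  have hfin : IsFiniteMeasure μ := by
    refine ⟨?_⟩
    rw [hμ _ MeasurableSet.univ]
    exact measure_lt_top _ _
  have hμA : μ (A N) = P W := by
    rw [hμ _ (hA N)]
    congr 1
    ext ω
    exact ⟨fun h => h.2, fun h => ⟨hWR ω h, h⟩⟩
  obtain ⟨ε, hε0, hε⟩ := exists_between (pos_iff_ne_zero.2 hWp)
  obtain ⟨B, hBJ, hBA, hBε⟩ := innerQ_of_measurable (μ := μ) hΛ (hA N) ε hε0.ne'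
  have hBpos : μ B ≠ 0 := by
    intro h0
    have : μ (A N) ≤ μ (A N \ B) + μ B :=
      (measure_mono (by intro p hp; by_cases hpB : p ∈ B <;> simp [hp, hpB])).trans
        (measure_union_le _ _)
    rw [h0, add_zero, hμA] at this
    exact absurd (this.trans hBε) (not_le.2 hε)
  rw [hμ _ hBJ.measurableSet] at hBpos
  obtain ⟨Y, hY, rfl⟩ := hBJ
  let D : Ω → ℝ≥0∞ := fun ω => ⨅ t ∈ {t : ℝ≥0 | ∀ n, 0 ≤ Y n (ω, t)}, (t : ℝ≥0∞)
  obtain ⟨T, hT, hTD, hmax⟩ := exists_max_time hΛ P D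
  have hgraph : ∀ᵐ ω ∂P, ∀ t : ℝ≥0, T ω = t → (ω, t) ∈ {p | ∀ n, 0 ≤ Y n p} := by
    have : ∀ n, ∀ᵐ ω ∂P, ∀ t : ℝ≥0, T ω = t → 0 ≤ Y n (ω, t) := by
      intro n
      obtain ⟨T', hT', hTT', h1, h2⟩ := next_time hΛ hT (hY n)
      have hD' : T' ≤ D := by
        intro ω
        refine le_iInf₂ fun t ht => ?_
        exact h1 ω t ((hTD ω).trans (iInf₂_le t ht)) (ht n)
      filter_upwards [hmax T' hT' hTT' hD'] with ω hω t ht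
      exact h2 ω t hω ht
    filter_upwards [ae_all_iff.2 this] with ω hω t ht n
    exact hω n t ht
  have hS : IsStoppingTimeM Λ (fun ω => min (T ω) (N : ℝ≥0)) := by
    unfold IsStoppingTimeM
    have : {p : Ω × ℝ≥0 | min (T p.1) ((N : ℝ≥0) : ℝ≥0∞) ≤ (p.2 : ℝ≥0∞)} =
        {p | T p.1 ≤ (p.2 : ℝ≥0∞)} ∪ univ ×ˢ Ici (N : ℝ≥0) := by
      ext p
      simp only [mem_ofPred_eq, min_le_iff, mem_union, mem_prod, mem_univ, true_and, mem_Ici,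
        ENNReal.coe_le_coe]
    rw [this]
    exact MeasurableSet.union hT (hΛ.contains_borel _ measurableSet_Ici)
  have hle := h _ hS ⟨N, fun ω => min_le_right _ _⟩
  apply hBpos
  have hae : ∀ᵐ ω ∂P, ω ∉ {ω | (ω, R ω) ∈ {p | ∀ n, 0 ≤ Y n p}} ∩ W := by
    filter_upwards [hgraph, hle] with ω hg hl hω
    have hTR : T ω ≤ R ω := (hTD ω).trans (iInf₂_le (R ω) hω.1)
    have hTtop : T ω ≠ ∞ := ne_top_of_le_ne_top ENNReal.coe_ne_top hTR
    lift T ω to ℝ≥0 using hTtop with t ht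
    have hA' := hBA (hg t rfl)
    have htN : t ≤ N := hA'.2.2
    have hlt : Z' (ω, t) < Z (ω, t) := hA'.1
    simp only [EvalAtF, ← ht] at hl
    rw [min_eq_left (by exact_mod_cast htN)] at hl
    simp only [ENNReal.toNNReal_coe] at hl
    exact absurd hlt (not_lt.2 hl)
  rw [ae_iff] at hae
  refine measure_mono_null ?_ hae
  intro ω hω hn
  exact hn hω

/-- If `Z_T ≤ Z'_T` a.s. at every bounded `Λ`-stopping time `T`, then
`{Z > Z'}` is evanescent; if `Z_T = Z'_T` a.s. at every bounded `Λ`-stopping time,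
then `Z` and `Z'` are indistinguishable. -/
theorem statement2 (P : Measure Ω) [IsProbabilityMeasure P] [hPc : P.IsComplete]
    (Λ : MeasurableSpace (Ω × ℝ≥0)) (hΛ : IsMeyer mΩ Λ)
    (Z Z' : Ω × ℝ≥0 → ℝ) (hZ : Measurable[Λ] Z) (hZ' : Measurable[Λ] Z') :
    ((∀ T : Ω → ℝ≥0∞, IsStoppingTimeM Λ T → (∃ C : ℝ≥0, ∀ ω, T ω ≤ (C : ℝ≥0∞)) →
        EvalAtF Z T ≤ᵐ[P] EvalAtF Z' T) →
      P {ω | ∃ t : ℝ≥0, Z' (ω, t) < Z (ω, t)} = 0) ∧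
    ((∀ T : Ω → ℝ≥0∞, IsStoppingTimeM Λ T → (∃ C : ℝ≥0, ∀ ω, T ω ≤ (C : ℝ≥0∞)) →
        EvalAtF Z T =ᵐ[P] EvalAtF Z' T) →
      Indistinguishable P Z Z') := by
  refine ⟨main_le P Λ hΛ Z Z' hZ hZ', fun h => ?_⟩
  have h1 := main_le P Λ hΛ Z Z' hZ hZ' fun T hT hC => (h T hT hC).le
  have h2 := main_le P Λ hΛ Z' Z hZ' hZ fun T hT hC => (h T hT hC).symm.le
  refine measure_mono_null ?_ (measure_union_null h1 h2)
  rintro ω ⟨t, ht⟩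
  rcases lt_or_gt_of_ne ht with h | h
  · exact Or.inr ⟨t, h⟩
  · exact Or.inl ⟨t, h⟩

end Meyer
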